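/- Let c ∈ ℝ^n, let X ⊆ ℝ^n and Y ⊆ ℝ^q be finite and nonempty, let A ∈ ℝ^{p×n}, D ∈ ℝ^{p×q}, b ∈ ℝ^p, and let d^1, …, d^m ∈ ℝ^q. Assume that for every x ∈ X and every i ∈ {1,…,m} the set {y ∈ Y : Ax + Dy ≤ b} is nonempty, and define Q_i(x) = min { (d^i)^⊤ y : y ∈ Y, Ax + Dy ≤ b }. Let I ⊆ {1,…,m} be nonempty, and suppose x* ∈ X together with (y^{*,i})_{i∈I} (y^{*,i} ∈ Y, Ax* + D y^{*,i} ≤ b) is optimal for the master problem, i.e., c^⊤ x* + μ* = val(I) where μ* = max_{i∈I} (d^i)^⊤ y^{*,i}. If max_{i∈{1,…,m}} Q_i(x*) ≤ μ*, then c^⊤ x* + max_{i∈{1,…,m}} Q_i(x*) = val({1,…,m}); in particular x* is an optimal first-stage solution of the full two-stage robust problem. -/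

import Mathlib

/-- Termination criterion of the column-and-constraint generation algorithm: if
`(xstar, (ystar_i)_{i∈I})` is optimal for the master problem over `I` with value
`c⬝xstar + μ*` and the adversarial value does not exceed `μ*`, then the adversarial value of
`xstar` equals the optimal value of the full two-stage robust problem. -/
theorem stmt_11 (n q p m : ℕ) (hm : 1 ≤ m) (c : Fin n → ℝ)
    (X : Finset (Fin n → ℝ)) (hX : X.Nonempty)
    (Y : Finset (Fin q → ℝ)) (hY : Y.Nonempty)
    (A : Matrix (Fin p) (Fin n) ℝ) (D : Matrix (Fin p) (Fin q) ℝ) (b : Fin p → ℝ)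
    (d : Fin m → Fin q → ℝ)
    (hfeas : ∀ x ∈ X, ∀ _i : Fin m, ∃ y ∈ Y,
      ∀ l, (∑ j, A l j * x j) + (∑ j, D l j * y j) ≤ b l)
    (I : Finset (Fin m)) (hI : I.Nonempty)
    (xstar : Fin n → ℝ) (hxstar : xstar ∈ X)
    (ystar : Fin m → (Fin q → ℝ))
    (hystar : ∀ i ∈ I, ystar i ∈ Y ∧
      ∀ l, (∑ j, A l j * xstar j) + (∑ j, D l j * ystar i j) ≤ b l)
    (hmaster : (∑ j, c j * xstar j) + I.sup' hI (fun i => ∑ j, d i j * ystar i j) =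
      sInf {v : ℝ | ∃ x ∈ X, ∃ y : Fin m → (Fin q → ℝ),
        (∀ i ∈ I, y i ∈ Y ∧ ∀ l, (∑ j, A l j * x j) + (∑ j, D l j * y i j) ≤ b l) ∧
        v = (∑ j, c j * x j) + I.sup' hI (fun i => ∑ j, d i j * y i j)})
    (hterm : Finset.univ.sup' (Finset.univ_nonempty_iff.mpr ⟨⟨0, hm⟩⟩)
        (fun i : Fin m => sInf {w : ℝ | ∃ y ∈ Y,
          (∀ l, (∑ j, A l j * xstar j) + (∑ j, D l j * y j) ≤ b l) ∧
          w = ∑ j, d i j * y j}) ≤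
      I.sup' hI (fun i => ∑ j, d i j * ystar i j)) :
    (∑ j, c j * xstar j) +
      Finset.univ.sup' (Finset.univ_nonempty_iff.mpr ⟨⟨0, hm⟩⟩)
        (fun i : Fin m => sInf {w : ℝ | ∃ y ∈ Y,
          (∀ l, (∑ j, A l j * xstar j) + (∑ j, D l j * y j) ≤ b l) ∧
          w = ∑ j, d i j * y j}) =
    sInf {v : ℝ | ∃ x ∈ X, ∃ y : Fin m → (Fin q → ℝ),
        (∀ i : Fin m, y i ∈ Y ∧ ∀ l, (∑ j, A l j * x j) + (∑ j, D l j * y i j) ≤ b l) ∧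
        v = (∑ j, c j * x j) +
          (Finset.univ.sup' (Finset.univ_nonempty_iff.mpr ⟨⟨0, hm⟩⟩)
            (fun i => ∑ j, d i j * y i j))} := by
  have attained : ∀ i : Fin m, sInf {w : ℝ | ∃ y ∈ Y,
      (∀ l, (∑ j, A l j * xstar j) + (∑ j, D l j * y j) ≤ b l) ∧ w = ∑ j, d i j * y j} ∈
      {w : ℝ | ∃ y ∈ Y,
        (∀ l, (∑ j, A l j * xstar j) + (∑ j, D l j * y j) ≤ b l) ∧ w = ∑ j, d i j * y j} := by
    intro i
    apply Set.Nonempty.csInf_mem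
    · obtain ⟨y, hy, hyb⟩ := hfeas xstar hxstar i
      exact ⟨_, y, hy, hyb, rfl⟩
    · refine (Y.finite_toSet.image fun y => ∑ j, d i j * y j).subset ?_
      rintro _ ⟨y, hy, -, rfl⟩
      exact ⟨y, hy, rfl⟩
  choose z hzY hzb hz using attained
  have master_bddBelow : BddBelow {v : ℝ | ∃ x ∈ X, ∃ y : Fin m → (Fin q → ℝ),
      (∀ i ∈ I, y i ∈ Y ∧ ∀ l, (∑ j, A l j * x j) + (∑ j, D l j * y i j) ≤ b l) ∧
      v = (∑ j, c j * x j) + I.sup' hI (fun i => ∑ j, d i j * y i j)} := by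
    obtain ⟨k, hk⟩ := id hI
    obtain ⟨B, hB⟩ := (X.finite_toSet.image fun x => ∑ j, c j * x j).bddBelow
    obtain ⟨C, hC⟩ := (Y.finite_toSet.image fun y => ∑ j, d k j * y j).bddBelow
    refine ⟨B + C, ?_⟩
    rintro _ ⟨x, hx, y, hy, rfl⟩
    exact add_le_add (hB ⟨x, hx, rfl⟩) ((hC ⟨y k, (hy k hk).1, rfl⟩).trans
      (Finset.le_sup' (fun i => ∑ j, d i j * y i j) hk))
  symm
  refine IsLeast.csInf_eq ⟨⟨xstar, hxstar, z, fun i => ⟨hzY i, hzb i⟩, ?_⟩, ?_⟩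
  · simp only [hz]
  · rintro _ ⟨x, hx, y, hy, rfl⟩
    calc _ ≤ _ := add_le_add le_rfl hterm
      _ = _ := hmaster
      _ ≤ (∑ j, c j * x j) + I.sup' hI (fun i => ∑ j, d i j * y i j) :=
        csInf_le master_bddBelow ⟨x, hx, y, fun i _ => hy i, rfl⟩
      _ ≤ _ := add_le_add le_rfl (Finset.sup'_mono _ (Finset.subset_univ I) hI)
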